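/- Let l ≥ 1 and n ≥ 4l+2 be integers, and let (u_0, …, u_{2l+1}) be an inscribed equilateral (2l+1)-pointed star in P_n with side length r satisfying 0 < r ≤ r_n. Then it is not the case that some u_i (0 ≤ i ≤ 2l) is a vertex of P_n and some u_j (0 ≤ j ≤ 2l) is a midpoint of an edge of P_n. -/

import Mathlib

noncomputable section

/-- The primitive `n`-th root of unity `ω = exp(2πi/n)`. -/
def nroot (n : ℕ) : ℂ := Complex.exp (2 * Real.pi * Complex.I / n)

/-- The boundary of the regular `n`-gon inscribed in the unit circle, as a subset of `ℂ`:
the union of the closed segments from `ω^j` to `ω^(j+1)` for `j = 0, …, n-1`. -/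
def polygon (n : ℕ) : Set ℂ :=
  ⋃ j ∈ Finset.range n, segment ℝ ((nroot n) ^ j) ((nroot n) ^ (j + 1))

/-- The critical scale `r_n`: `2 cos(π/n)` for even `n`,
and `1 + cos(2π/n)/cos(π/n)` for odd `n`. -/
def rpoly (n : ℕ) : ℝ :=
  if Even n then 2 * Real.cos (Real.pi / n)
  else 1 + Real.cos (2 * Real.pi / n) / Real.cos (Real.pi / n)

/-- Arc-length parametrization of the polygon `P_n` by the parameter `t` (normalized so that
`t ∈ [0,1)` traverses the polygon once counterclockwise, with vertices at `t = j/n`). -/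
def polyParam (n : ℕ) (t : ℝ) : ℂ :=
  ((1 - Int.fract (n * t) : ℝ) : ℂ) * (nroot n) ^ (⌊(n : ℝ) * t⌋) +
    ((Int.fract (n * t) : ℝ) : ℂ) * (nroot n) ^ (⌊(n : ℝ) * t⌋ + 1)

/-- The parameter value in `[0,1)` of a point `x ∈ P_n`. -/
def polyArg (n : ℕ) (x : ℂ) : ℝ :=
  sInf {t : ℝ | t ∈ Set.Ico (0 : ℝ) 1 ∧ polyParam n t = x}

/-- The normalized counterclockwise arc distance from `x` to `y` along `P_n`: the length of the
counterclockwise path along `P_n` from `x` to `y` divided by the total perimeter of `P_n`. -/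
def polyDist (n : ℕ) (x y : ℂ) : ℝ := Int.fract (polyArg n y - polyArg n x)

/-- `z` is strictly counterclockwise-between `x` and `y` on `P_n`. -/
def SCCWBtw (n : ℕ) (x z y : ℂ) : Prop :=
  0 < polyDist n x z ∧ polyDist n x z < polyDist n x y

/-- An inscribed equilateral `(2l+1)`-pointed star of side length `r` based at `p ∈ P_n`:
a tuple `(u 0, …, u (2l+1))` of points of `P_n` with `u 0 = u (2l+1) = p`, where consecutive
points are at Euclidean distance `r`, every point of `P_n` strictly counterclockwise-between
`u i` and `u (i+1)` is at distance `< r` from `u i`, and the total winding number is `l`. -/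
def IsStar (n l : ℕ) (r : ℝ) (p : ℂ) (u : ℕ → ℂ) : Prop :=
  u 0 = p ∧ u (2 * l + 1) = p ∧
  (∀ i ≤ 2 * l + 1, u i ∈ polygon n) ∧
  (∀ i ≤ 2 * l, dist (u i) (u (i + 1)) = r) ∧
  (∀ i ≤ 2 * l, ∀ z ∈ polygon n, SCCWBtw n (u i) z (u (i + 1)) → dist (u i) z < r) ∧
  (∑ i ∈ Finset.range (2 * l + 1), polyDist n (u i) (u (i + 1))) = (l : ℝ)

/-- `x` is a vertex of `P_n`. -/
def IsVertex (n : ℕ) (x : ℂ) : Prop := ∃ j < n, x = (nroot n) ^ j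

/-- `x` is the midpoint of an edge of `P_n`. -/
def IsMidpoint (n : ℕ) (x : ℂ) : Prop :=
  ∃ j < n, x = ((nroot n) ^ j + (nroot n) ^ (j + 1)) / 2

end

/-- The parametrization of the polygon by edge index: `gam n j = ω ^ j` for integers `j`,
affine on every `[j, j + 1]`. -/
noncomputable def gam (n : ℕ) (s : ℝ) : ℂ :=
  ((1 - Int.fract s : ℝ) : ℂ) * (nroot n) ^ ⌊s⌋ + ((Int.fract s : ℝ) : ℂ) * (nroot n) ^ (⌊s⌋ + 1)

/-- Euclidean distance between the points of the polygon with edge parameters `a` and `b`. -/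
noncomputable def gdist (n : ℕ) (a b : ℝ) : ℝ := dist (gam n a) (gam n b)

/-- `b` is the first parameter after `a` at which the polygon is at distance `r` from `gam n a`. -/
def FirstHit (n : ℕ) (r a b : ℝ) : Prop :=
  a < b ∧ gdist n a b = r ∧ ∀ c, a < c → c < b → gdist n a c < r

lemma polyParam_eq_gam (n : ℕ) (t : ℝ) : polyParam n t = gam n (n * t) := rfl

lemma nroot_zpow (n : ℕ) (k : ℤ) :
    nroot n ^ k = Complex.exp (((2 * k * (Real.pi / n) : ℝ) : ℂ) * Complex.I) := by
  rw [nroot, ← Complex.exp_int_mul]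
  congr 1
  push_cast
  ring

lemma nroot_zpow_eq (n : ℕ) (k : ℤ) :
    nroot n ^ k = (Real.cos (2 * k * (Real.pi / n)) : ℂ) +
      (Real.sin (2 * k * (Real.pi / n)) : ℂ) * Complex.I := by
  rw [nroot_zpow, Complex.exp_mul_I, Complex.ofReal_cos, Complex.ofReal_sin]

lemma gam_of_mem_edge {n : ℕ} {j : ℤ} {t : ℝ} (h0 : (j : ℝ) ≤ t) (h1 : t ≤ j + 1) :
    gam n t = ((1 - (t - j) : ℝ) : ℂ) * nroot n ^ j + ((t - j : ℝ) : ℂ) * nroot n ^ (j + 1) := by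
  rcases h1.lt_or_eq with h | h
  · have hf : ⌊t⌋ = j := Int.floor_eq_iff.2 ⟨h0, h⟩
    simp only [gam, Int.fract, hf]
  · have hf : ⌊t⌋ = j + 1 := by rw [h]; exact_mod_cast Int.floor_intCast (j + 1)
    simp [gam, Int.fract, h]

lemma gam_intCast (n : ℕ) (j : ℤ) : gam n j = nroot n ^ j := by
  rw [gam_of_mem_edge le_rfl (by linarith)]
  simp

/-- Coordinates of a point of edge `j` in the frame centred at the midpoint of that edge. -/
lemma gam_frame {n : ℕ} {j : ℤ} {t : ℝ} (h0 : (j : ℝ) ≤ t) (h1 : t ≤ j + 1) :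
    gam n t = ((Real.cos ((2 * j + 1) * (Real.pi / n)) * Real.cos (Real.pi / n)
        - Real.sin ((2 * j + 1) * (Real.pi / n)) * ((2 * (t - j) - 1) * Real.sin (Real.pi / n))
          : ℝ) : ℂ)
      + ((Real.sin ((2 * j + 1) * (Real.pi / n)) * Real.cos (Real.pi / n)
        + Real.cos ((2 * j + 1) * (Real.pi / n)) * ((2 * (t - j) - 1) * Real.sin (Real.pi / n))
          : ℝ) : ℂ) * Complex.I := by
  rw [gam_of_mem_edge h0 h1, nroot_zpow_eq, nroot_zpow_eq]
  set θ := Real.pi / n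
  have e1 : 2 * (j : ℝ) * θ = (2 * j + 1) * θ - θ := by ring
  have e2 : 2 * ((j + 1 : ℤ) : ℝ) * θ = (2 * j + 1) * θ + θ := by push_cast; ring
  rw [e1, e2, Real.cos_sub, Real.cos_add, Real.sin_sub, Real.sin_add]
  push_cast
  ring

lemma gam_add_int (n : ℕ) (t : ℝ) (k : ℤ) : gam n (t + k) = nroot n ^ k * gam n t := by
  have h : nroot n ≠ 0 := Complex.exp_ne_zero _
  simp only [gam, Int.fract_add_intCast, Int.floor_add_intCast, zpow_add₀ h]
  ring

lemma nroot_zpow_self {n : ℕ} (hn : n ≠ 0) : nroot n ^ (n : ℤ) = 1 := by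
  rw [nroot, ← Complex.exp_int_mul]
  have : ((n : ℤ) : ℂ) * (2 * Real.pi * Complex.I / n) = 2 * Real.pi * Complex.I := by
    have : (n : ℂ) ≠ 0 := by exact_mod_cast hn
    push_cast
    field_simp
  rw [this, Complex.exp_two_pi_mul_I]

lemma gam_add_period {n : ℕ} (hn : n ≠ 0) (t : ℝ) (k : ℤ) : gam n (t + n * k) = gam n t := by
  have h := gam_add_int n t (n * k)
  push_cast at h
  rw [h, zpow_mul, nroot_zpow_self hn, one_zpow, one_mul]

lemma norm_nroot_zpow (n : ℕ) (k : ℤ) : ‖nroot n ^ k‖ = 1 := by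
  rw [nroot_zpow, Complex.norm_exp_ofReal_mul_I]

lemma gam_neg (n : ℕ) (t : ℝ) : gam n (-t) = starRingEnd ℂ (gam n t) := by
  have h0 := Int.floor_le t
  have h1 := (Int.lt_floor_add_one t).le
  rw [gam_frame h0 h1, gam_frame (j := -⌊t⌋ - 1) (by push_cast; linarith) (by push_cast; linarith)]
  set θ := Real.pi / n
  have e : (2 * ((-⌊t⌋ - 1 : ℤ) : ℝ) + 1) * θ = -((2 * ⌊t⌋ + 1) * θ) := by push_cast; ring
  rw [e, Real.cos_neg, Real.sin_neg]
  generalize Real.cos ((2 * ⌊t⌋ + 1) * θ) = c, Real.sin ((2 * ⌊t⌋ + 1) * θ) = s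
  generalize Real.cos θ = C, Real.sin θ = S
  simp only [map_add, map_mul, Complex.conj_ofReal, Complex.conj_I]
  push_cast
  ring

lemma gdist_comm (n : ℕ) (a b : ℝ) : gdist n a b = gdist n b a := dist_comm _ _

lemma gdist_add_int (n : ℕ) (a b : ℝ) (k : ℤ) : gdist n (a + k) (b + k) = gdist n a b := by
  rw [gdist, gdist, gam_add_int, gam_add_int, dist_eq_norm, dist_eq_norm, ← mul_sub, norm_mul,
    norm_nroot_zpow, one_mul]

lemma gdist_neg (n : ℕ) (a b : ℝ) : gdist n (-a) (-b) = gdist n a b := by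
  rw [gdist, gdist, gam_neg, gam_neg, dist_eq_norm, dist_eq_norm, ← map_sub, RCLike.norm_conj]

lemma gdist_int_sub (n : ℕ) (a b : ℝ) (k : ℤ) : gdist n (k - a) (k - b) = gdist n a b := by
  rw [← gdist_neg n a b, ← gdist_add_int n (-a) (-b) k]
  congr 1 <;> ring

lemma gdist_nonneg (n : ℕ) (a b : ℝ) : 0 ≤ gdist n a b := dist_nonneg

lemma gdist_sq {n : ℕ} {j : ℤ} {a t : ℝ} (ha0 : 0 ≤ a) (ha1 : a ≤ 1) (h0 : (j : ℝ) ≤ t)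
    (h1 : t ≤ j + 1) {C S c s : ℝ} (hC : C = Real.cos (Real.pi / n))
    (hS : S = Real.sin (Real.pi / n)) (hc : c = Real.cos (2 * j * (Real.pi / n)))
    (hs : s = Real.sin (2 * j * (Real.pi / n))) :
    gdist n a t ^ 2 = (C - C * c - (2 * a - 1) * S * s) ^ 2 +
      ((2 * (t - j) - 1) * S - (2 * a - 1) * S * c + C * s) ^ 2 := by
  rw [gdist, gam_frame (j := 0) (by simpa using ha0) (by simpa using ha1), gam_frame h0 h1]
  have e : (2 * (j : ℝ) + 1) * (Real.pi / n) = 2 * j * (Real.pi / n) + Real.pi / n := by ring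
  rw [e, Real.cos_add, Real.sin_add, Complex.dist_eq, Complex.sq_norm, Complex.normSq_apply]
  have h1 := Real.sin_sq_add_cos_sq (Real.pi / n)
  have h2 := Real.sin_sq_add_cos_sq (2 * j * (Real.pi / n))
  rw [← hS, ← hC] at h1
  rw [← hs, ← hc] at h2
  simp only [← hC, ← hS, ← hc, ← hs, Int.cast_zero, mul_zero, zero_add, one_mul, sub_zero]
  simp
  linear_combination
    ((c * C - s * ((2 * (t - j) - 1) * S) - C) ^ 2 +
      (s * C + c * ((2 * (t - j) - 1) * S) - (2 * a - 1) * S) ^ 2) * h1 +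
    (((2 * (t - j) - 1) * S) ^ 2 - ((2 * a - 1) * S) ^ 2) * h2
lemma sin_le_sin_of_mem {θ x : ℝ} (h0 : 0 ≤ θ) (h1 : θ ≤ x) (h2 : x ≤ Real.pi - θ) :
    Real.sin θ ≤ Real.sin x := by
  have h := Real.sin_sub_sin x θ
  have := Real.sin_nonneg_of_nonneg_of_le_pi (x := (x - θ) / 2) (by linarith) (by linarith)
  have := Real.cos_nonneg_of_mem_Icc (x := (x + θ) / 2) ⟨by linarith, by linarith⟩
  nlinarith [mul_nonneg ‹0 ≤ Real.sin ((x - θ) / 2)› this]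

lemma sin_pi_div_pos {n : ℕ} (hn : 2 ≤ n) : 0 < Real.sin (Real.pi / n) := by
  have hn' : (2 : ℝ) ≤ n := by exact_mod_cast hn
  refine Real.sin_pos_of_pos_of_lt_pi (by positivity) ?_
  exact div_lt_self Real.pi_pos (by linarith)

lemma cos_pi_div_pos {n : ℕ} (hn : 3 ≤ n) : 0 < Real.cos (Real.pi / n) := by
  have hn' : (3 : ℝ) ≤ n := by exact_mod_cast hn
  have h : 0 < Real.pi / n := by positivity
  refine Real.cos_pos_of_mem_Ioo ⟨by linarith [Real.pi_pos], ?_⟩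
  exact div_lt_div_of_pos_left Real.pi_pos (by norm_num) (by linarith)

/-- The distance from a point of edge `0` increases along edge `j` when the foot of the
perpendicular precedes that edge. -/
lemma gdist_lt_of_foot {n : ℕ} (hn : 2 ≤ n) {j : ℤ} {a c d : ℝ} (ha0 : 0 ≤ a) (ha1 : a ≤ 1)
    (hjc : (j : ℝ) ≤ c) (hcd : c < d) (hdj : d ≤ j + 1)
    (hfoot : 0 ≤ Real.cos (Real.pi / n) * Real.sin (2 * j * (Real.pi / n)) -
      (2 * a - 1) * Real.sin (Real.pi / n) * Real.cos (2 * j * (Real.pi / n)) -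
      Real.sin (Real.pi / n)) : gdist n a c < gdist n a d := by
  have hS := sin_pi_div_pos hn
  refine lt_of_pow_lt_pow_left₀ 2 (gdist_nonneg _ _ _) ?_
  rw [gdist_sq ha0 ha1 hjc (by linarith) rfl rfl rfl rfl,
    gdist_sq ha0 ha1 (by linarith) hdj rfl rfl rfl rfl]
  refine add_lt_add_right (pow_lt_pow_left₀ ?_ ?_ two_ne_zero) _
  · nlinarith
  · nlinarith

lemma gdist_lt_on_edge {n : ℕ} (hn : 2 ≤ n) {j : ℕ} (hj : 1 ≤ j) (hjn : 2 * j + 2 ≤ n)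
    {a c d : ℝ} (ha0 : 0 ≤ a) (ha1 : a ≤ 1) (hjc : (j : ℝ) ≤ c) (hcd : c < d)
    (hdj : d ≤ j + 1) : gdist n a c < gdist n a d := by
  refine gdist_lt_of_foot (j := j) hn ha0 ha1 (by simpa using hjc) hcd (by simpa using hdj) ?_
  have hn0 : (0 : ℝ) < n := by exact_mod_cast (by omega : 0 < n)
  have hπ : n * (Real.pi / n) = Real.pi := by field_simp
  have hθ : 0 < Real.pi / n := by positivity
  rw [Int.cast_natCast]
  set θ := Real.pi / n
  have hj' : (1 : ℝ) ≤ j := by exact_mod_cast hj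
  have hjn' : 2 * (j : ℝ) + 2 ≤ n := by exact_mod_cast hjn
  have h1 : θ ≤ j * θ := by nlinarith
  have h2 : 2 * (j * θ) + 2 * θ ≤ Real.pi := by nlinarith
  have h3 := sin_le_sin_of_mem (θ := θ) (x := 2 * j * θ - θ) hθ.le (by linarith) (by linarith)
  have h4 := sin_le_sin_of_mem (θ := θ) (x := 2 * j * θ + θ) hθ.le (by linarith) (by linarith)
  rw [Real.sin_sub] at h3
  rw [Real.sin_add] at h4
  nlinarith [mul_nonneg ha0 (sub_nonneg.2 h3), mul_nonneg (sub_nonneg.2 ha1) (sub_nonneg.2 h4)]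

lemma gdist_edge_zero {n : ℕ} {a t : ℝ} (ha0 : 0 ≤ a) (ha1 : a ≤ 1) (ht0 : 0 ≤ t) (ht1 : t ≤ 1) :
    gdist n a t ^ 2 = (2 * (t - a) * Real.sin (Real.pi / n)) ^ 2 := by
  rw [gdist_sq (j := 0) ha0 ha1 (by simpa using ht0) (by simpa using ht1) rfl rfl rfl rfl]
  simp
  ring

lemma strictMonoOn_gdist {n : ℕ} {a : ℝ} (ha0 : 0 ≤ a) (ha1 : a < 1) {k : ℕ}
    (hk : 1 ≤ k) (hkn : 2 * k ≤ n) : StrictMonoOn (gdist n a) (Set.Icc a k) := by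
  have hn : 2 ≤ n := by omega
  induction k, hk using Nat.le_induction with
  | base =>
    rintro c ⟨hc0, hc1⟩ d ⟨hd0, hd1⟩ hcd
    have hS := sin_pi_div_pos hn
    norm_num at hc1 hd1
    refine lt_of_pow_lt_pow_left₀ 2 (gdist_nonneg _ _ _) ?_
    rw [gdist_edge_zero ha0 ha1.le (by linarith) hc1, gdist_edge_zero ha0 ha1.le (by linarith) hd1]
    refine pow_lt_pow_left₀ ?_ ?_ two_ne_zero
    · exact mul_lt_mul_of_pos_right (by linarith) hS
    · have := sub_nonneg.2 hc0
      positivity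
  | succ k hk ih =>
    have hk' : (1 : ℝ) ≤ k := by exact_mod_cast hk
    have h1 : StrictMonoOn (gdist n a) (Set.Icc (k : ℝ) (k + 1)) := fun c hc d hd hcd =>
      gdist_lt_on_edge hn hk (by omega) ha0 ha1.le hc.1 hcd hd.2
    have h2 := (ih (by omega)).union h1 (c := (k : ℝ)) ⟨⟨by linarith, le_rfl⟩, fun x hx => hx.2⟩
      ⟨⟨le_rfl, by linarith⟩, fun x hx => hx.1⟩
    rw [Set.Icc_union_Icc_eq_Icc (by linarith) (by linarith)] at h2
    exact_mod_cast h2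

lemma le_of_sq_eq_add {x y z : ℝ} (hx : 0 ≤ x) (h : x ^ 2 = y ^ 2 + z ^ 2) : y ≤ x :=
  le_of_sq_le_sq (by nlinarith [sq_nonneg z]) hx

lemma rpoly_le_gdist_even {m : ℕ} (hm : 2 ≤ m) {a : ℝ} (ha0 : 0 ≤ a) (ha1 : a ≤ 1) :
    rpoly (m + m) ≤ gdist (m + m) a m := by
  have hm0 : (0 : ℝ) < m := by exact_mod_cast (by omega : 0 < m)
  have e : 2 * (m : ℝ) * (Real.pi / (m + m : ℕ)) = Real.pi := by push_cast; field_simp; ring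
  have h := gdist_sq (n := m + m) (j := m) (t := m) ha0 ha1 (by simp) (by simp) rfl rfl rfl rfl
  rw [Int.cast_natCast, e, Real.cos_pi, Real.sin_pi] at h
  refine le_trans (le_of_eq ?_) (le_of_sq_eq_add (gdist_nonneg _ _ _) h)
  rw [rpoly, if_pos ⟨m, rfl⟩]
  ring

lemma rpoly_odd {m : ℕ} (hm : 1 ≤ m) : rpoly (2 * m + 1) =
    1 + Real.cos (Real.pi / (2 * m + 1 : ℕ)) -
      Real.sin (Real.pi / (2 * m + 1 : ℕ)) ^ 2 / Real.cos (Real.pi / (2 * m + 1 : ℕ)) := by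
  have hC := cos_pi_div_pos (n := 2 * m + 1) (by omega)
  rw [rpoly, if_neg (by simp), mul_div_assoc, Real.cos_two_mul']
  field_simp
  ring

lemma odd_angle (m : ℕ) : 2 * (m : ℝ) * (Real.pi / (2 * m + 1 : ℕ)) =
    Real.pi - Real.pi / (2 * m + 1 : ℕ) := by
  have : (0 : ℝ) < 2 * m + 1 := by positivity
  push_cast
  field_simp
  ring

lemma rpoly_le_gdist_odd {m : ℕ} (hm : 1 ≤ m) {a : ℝ} (ha0 : 0 ≤ a) (ha1 : a ≤ 1) :
    rpoly (2 * m + 1) ≤ gdist (2 * m + 1) a (m + 1) := by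
  have h := gdist_sq (n := 2 * m + 1) (j := m) (t := m + 1) ha0 ha1 (by simp) (by simp) rfl rfl
    rfl rfl
  have hC := cos_pi_div_pos (n := 2 * m + 1) (by omega)
  have h1 := Real.sin_sq_add_cos_sq (Real.pi / (2 * m + 1 : ℕ))
  rw [Int.cast_natCast, odd_angle, Real.cos_pi_sub, Real.sin_pi_sub] at h
  rw [rpoly_odd hm]
  set C := Real.cos (Real.pi / (2 * m + 1 : ℕ))
  set S := Real.sin (Real.pi / (2 * m + 1 : ℕ))
  have h2 : 0 ≤ S ^ 2 / C := by positivity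
  suffices 1 + C ≤ gdist (2 * m + 1) a (m + 1) by linarith
  refine le_of_sq_eq_add (z := S * (2 * a - 1)) (gdist_nonneg _ _ _) (h.trans ?_)
  linear_combination ((2 * a - 1) ^ 2 * S ^ 2 + (1 + C) ^ 2) * h1

/-- On the edge opposite to a vertex, the distance from a point of edge `0` increases as long as
it does not exceed the critical scale. -/
lemma gdist_lt_of_le_rpoly {m : ℕ} (hm : 1 ≤ m) {a c d : ℝ} (ha0 : 0 ≤ a) (ha1 : a ≤ 1)
    (hc : (m : ℝ) ≤ c) (hcd : c < d) (hd : d ≤ m + 1)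
    (hr : gdist (2 * m + 1) a d ≤ rpoly (2 * m + 1)) :
    gdist (2 * m + 1) a c < gdist (2 * m + 1) a d := by
  refine gdist_lt_of_foot (j := m) (by omega) ha0 ha1 (by simpa using hc) hcd (by simpa using hd) ?_
  have h := gdist_sq (n := 2 * m + 1) (j := m) (t := d) ha0 ha1 (by simp; linarith)
    (by simpa using hd) rfl rfl rfl rfl
  have hC := cos_pi_div_pos (n := 2 * m + 1) (by omega)
  have hS := sin_pi_div_pos (n := 2 * m + 1) (by omega)
  have h1 := Real.sin_sq_add_cos_sq (Real.pi / (2 * m + 1 : ℕ))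
  rw [Int.cast_natCast, odd_angle, Real.cos_pi_sub, Real.sin_pi_sub] at h ⊢
  have h2 := (le_of_sq_eq_add (gdist_nonneg _ _ _) h).trans hr
  rw [rpoly_odd hm] at h2
  set C := Real.cos (Real.pi / (2 * m + 1 : ℕ))
  set S := Real.sin (Real.pi / (2 * m + 1 : ℕ))
  have h3 : S ^ 2 / C * C = S ^ 2 := by field_simp
  have h4 : S ^ 2 / C ≤ (2 * a - 1) * S ^ 2 + S ^ 2 := by nlinarith
  have h5 : S ^ 2 ≤ ((2 * a - 1) * S ^ 2 + S ^ 2) * C := by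
    have := mul_le_mul_of_nonneg_right h4 hC.le
    rwa [h3] at this
  have h6 : S * S ≤ S * (C * S + (2 * a - 1) * S * C) := by nlinarith
  have h7 := le_of_mul_le_mul_left h6 hS
  linarith

lemma FirstHit.add_int {n : ℕ} {r a b : ℝ} (h : FirstHit n r a b) (k : ℤ) :
    FirstHit n r (a + k) (b + k) := by
  refine ⟨by linarith [h.1], by rw [gdist_add_int, h.2.1], fun c h1 h2 => ?_⟩
  have := h.2.2 (c - k) (by linarith) (by linarith)
  rwa [← gdist_add_int n _ _ k, sub_add_cancel] at this

/-- Below the critical scale, the first point at distance `r` counterclockwise from `a` has `a` as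
its first point at distance `r` clockwise. -/
lemma FirstHit.gdist_lt {n : ℕ} (hn : 4 ≤ n) {r a b c : ℝ} (hr : r ≤ rpoly n)
    (h : FirstHit n r a b) (hac : a < c) (hcb : c < b) : gdist n c b < r := by
  wlog ha : 0 ≤ a ∧ a < 1 generalizing a b c
  · have := this (h.add_int (-⌊a⌋)) (c := c + (-⌊a⌋ : ℤ)) (by linarith) (by linarith)
      (by push_cast; constructor <;> linarith [Int.floor_le a, Int.lt_floor_add_one a])
    rwa [gdist_add_int] at this
  obtain ⟨ha0, ha1⟩ := ha
  obtain ⟨hab, hD, hlt⟩ := h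
  set K : ℤ := ⌈b⌉ with hK
  have hK0 := Int.le_ceil b
  have hK1 := Int.ceil_lt_add_one b
  rw [← hK] at hK0 hK1
  rw [gdist_comm, ← gdist_int_sub n _ _ K]
  rw [gdist_comm, ← gdist_int_sub n _ _ K] at hD
  rw [← hD]
  rcases Nat.even_or_odd' n with ⟨m, rfl | rfl⟩
  · have hbm : b ≤ m := by
      by_contra! hb
      have h1 := hlt m (ha1.trans_le (by exact_mod_cast (by omega : 1 ≤ m))) hb
      rw [two_mul] at h1 hr
      linarith [rpoly_le_gdist_even (by omega : 2 ≤ m) ha0 ha1.le]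
    have hKm : (K : ℝ) ≤ m := by exact_mod_cast Int.ceil_le.2 (by exact_mod_cast hbm)
    exact strictMonoOn_gdist (by linarith) (by linarith) (by omega) le_rfl
      ⟨by linarith, by linarith⟩ ⟨by linarith, by linarith⟩ (by linarith)
  · have hbm : b ≤ m + 1 := by
      by_contra! hb
      have h1 := hlt (m + 1) (by have := m.cast_nonneg (α := ℝ); linarith) hb
      linarith [rpoly_le_gdist_odd (by omega : 1 ≤ m) ha0 ha1.le]
    have hKm : (K : ℝ) ≤ m + 1 := by
      have : K ≤ m + 1 := Int.ceil_le.2 (by push_cast; exact hbm)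
      exact_mod_cast this
    have hm1 : (1 : ℝ) ≤ m := by exact_mod_cast (by omega : 1 ≤ m)
    have hmono := strictMonoOn_gdist (n := 2 * m + 1) (a := K - b) (k := m) (by linarith)
      (by linarith) (by omega) (by omega)
    have hlast : ∀ {x}, (m : ℝ) ≤ x → x < K - a →
        gdist (2 * m + 1) (K - b) x < gdist (2 * m + 1) (K - b) (K - a) := fun h1 h2 =>
      gdist_lt_of_le_rpoly (by omega) (by linarith) (by linarith) h1 h2 (by linarith)
        (by rw [hD]; exact hr)
    rcases le_or_gt (K - a) (m : ℝ) with h1 | h1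
    · exact hmono ⟨by linarith, by linarith⟩ ⟨by linarith, h1⟩ (by linarith)
    rcases le_or_gt (m : ℝ) (K - c) with h2 | h2
    · exact hlast h2 (by linarith)
    · exact (hmono ⟨by linarith, by linarith⟩ ⟨by linarith, le_rfl⟩ h2).trans (hlast le_rfl h1)

lemma FirstHit.unique {n : ℕ} {r a b b' : ℝ} (h : FirstHit n r a b) (h' : FirstHit n r a b') :
    b = b' := by
  rcases lt_trichotomy b b' with hb | hb | hb
  · exact absurd (h'.2.2 b h.1 hb) (by rw [h.2.1]; exact lt_irrefl _)
  · exact hb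
  · exact absurd (h.2.2 b' h'.1 hb) (by rw [h'.2.1]; exact lt_irrefl _)

lemma FirstHit.reflect {n : ℕ} (hn : 4 ≤ n) {r a b : ℝ} (hr : r ≤ rpoly n)
    (h : FirstHit n r a b) (k : ℤ) : FirstHit n r (k - b) (k - a) := by
  refine ⟨by linarith [h.1], by rw [gdist_int_sub, gdist_comm, h.2.1], fun c h1 h2 => ?_⟩
  have := h.gdist_lt hn hr (c := k - c) (by linarith) (by linarith)
  rwa [gdist_comm, ← gdist_int_sub n _ _ k, sub_sub_cancel] at this

lemma FirstHit.unique_left {n : ℕ} (hn : 4 ≤ n) {r a a' b : ℝ} (hr : r ≤ rpoly n)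
    (h : FirstHit n r a b) (h' : FirstHit n r a' b) : a = a' := by
  linarith [(h.reflect hn hr 0).unique (h'.reflect hn hr 0)]

/-- A chain of first hits through `s i` with `2 * s i` an integer is symmetric about `s i`. -/
lemma chain_reflect {n : ℕ} (hn : 4 ≤ n) {r : ℝ} (hr : r ≤ rpoly n) {s : ℤ → ℝ}
    (hs : ∀ i, FirstHit n r (s i) (s (i + 1))) {i M : ℤ} (hM : 2 * s i = M) (k : ℤ) :
    s (2 * i - k) = 2 * s i - s k := by
  have key : ∀ t : ℤ, s (i + t) = 2 * s i - s (i - t) := by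
    intro t
    induction t using Int.induction_on with
    | zero => simp; ring
    | succ t ih =>
      have h1 := hs (i + t)
      have h2 := (hs (i - (t + 1))).reflect hn hr M
      rw [ih] at h1
      rw [← hM, show i - ((t : ℤ) + 1) + 1 = i - t by ring] at h2
      rw [← add_assoc]
      exact h1.unique h2
    | pred t ih =>
      have h1 := hs (i + (-t - 1))
      have h2 := (hs (i - -t)).reflect hn hr M
      rw [show i + (-(t : ℤ) - 1) + 1 = i + -t by ring, ih] at h1
      rw [← hM, show i - -(t : ℤ) + 1 = i - (-t - 1) by ring] at h2
      exact h1.unique_left hn hr h2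
  have := key (i - k)
  rwa [sub_sub_cancel, ← add_sub_assoc, ← two_mul] at this

/-- A chain of first hits that closes up after an odd number of steps cannot contain both an
integer and a half-integer parameter. -/
lemma chain_no_vertex_midpoint {n : ℕ} (hn : 4 ≤ n) {r : ℝ} (hr : r ≤ rpoly n) {s : ℤ → ℝ}
    (hs : ∀ i, FirstHit n r (s i) (s (i + 1))) {N M : ℤ} (hN : Odd N)
    (hper : ∀ i, s (i + N) = s i + M) {i j a b : ℤ} (hi : s i = a) (hj : s j = b + 1 / 2) :
    False := by
  have hshift : ∀ k, s (k + 2 * (i - j)) = s k + 2 * (s i - s j) := by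
    intro k
    have h1 := chain_reflect hn hr hs (i := i) (M := 2 * a) (by rw [hi]; push_cast; ring)
      (2 * j - k)
    have h2 := chain_reflect hn hr hs (i := j) (M := 2 * b + 1) (by rw [hj]; push_cast; ring) k
    rw [h2] at h1
    rw [show k + 2 * (i - j) = 2 * i - (2 * j - k) by ring, h1]
    ring
  have iter : ∀ {d : ℤ} {x : ℝ}, (∀ k, s (k + d) = s k + x) →
      ∀ q : ℤ, s (q * d) = s 0 + q * x := by
    intro d x h q
    induction q using Int.induction_on with
    | zero => simp
    | succ q ih => rw [add_mul, one_mul, h, ih]; push_cast; ring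
    | pred q ih =>
      have := h ((-q - 1) * d)
      rw [show (-(q : ℤ) - 1) * d + d = -q * d by ring, ih] at this
      push_cast at this ⊢
      linarith
  have h1 := iter hshift N
  have h2 := iter hper (2 * (i - j))
  rw [mul_comm, h1, hi, hj] at h2
  have h3 : 2 * N * a - 2 * N * b - N = 2 * (i - j) * M := by
    have : (2 * N * a - 2 * N * b - N : ℝ) = 2 * (i - j) * M := by
      push_cast at h2
      linarith
    exact_mod_cast this
  obtain ⟨k, rfl⟩ := hN
  have : (2 : ℤ) ∣ 1 := ⟨(2 * k + 1) * a - (2 * k + 1) * b - k - (i - j) * M, by linarith⟩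
  norm_num at this

lemma gam_injOn {n : ℕ} (hn : 3 ≤ n) {a t : ℝ} (ha0 : 0 ≤ a) (ha1 : a < 1) (ht0 : 0 ≤ t)
    (htn : t < n) (h : gam n a = gam n t) : a = t := by
  have hS := sin_pi_div_pos (n := n) (by omega)
  have hn0 : (0 : ℝ) < n := by exact_mod_cast (by omega : 0 < n)
  have hθ0 : 0 < Real.pi / n := by positivity
  have hπ : n * (Real.pi / n) = Real.pi := by field_simp
  have hd : gdist n a t = 0 := by rw [gdist, h, dist_self]
  obtain ⟨j, hj⟩ := Int.eq_ofNat_of_zero_le (Int.floor_nonneg.2 ht0)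
  have hj0 : (j : ℝ) ≤ t := by have := Int.floor_le t; rw [hj] at this; exact_mod_cast this
  have hj1 : t < j + 1 := by have := Int.lt_floor_add_one t; rw [hj] at this; exact_mod_cast this
  have hjn : (j : ℝ) + 1 ≤ n := by
    have : (j : ℝ) < n := hj0.trans_lt htn
    exact_mod_cast this
  rcases Nat.eq_zero_or_pos j with rfl | hjpos
  · have := gdist_edge_zero (n := n) ha0 ha1.le ht0 (by simpa using hj1.le)
    rw [hd, zero_pow two_ne_zero, eq_comm, pow_eq_zero_iff two_ne_zero] at this
    have := (mul_eq_zero.1 this).resolve_right hS.ne'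
    linarith
  exfalso
  have hj1' : (1 : ℝ) ≤ j := by exact_mod_cast hjpos
  have hsq := gdist_sq (n := n) (j := j) (t := t) ha0 ha1.le (by simpa using hj0)
    (by simpa using hj1.le) rfl rfl rfl rfl
  rw [hd, Int.cast_natCast] at hsq
  set θ := Real.pi / n
  have e1 : Real.cos θ - Real.cos θ * Real.cos (2 * j * θ) -
      (2 * a - 1) * Real.sin θ * Real.sin (2 * j * θ) = 0 := by nlinarith
  have e2 : (2 * (t - j) - 1) * Real.sin θ - (2 * a - 1) * Real.sin θ * Real.cos (2 * j * θ) +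
      Real.cos θ * Real.sin (2 * j * θ) = 0 := by nlinarith
  have hjθ : θ ≤ j * θ := by nlinarith
  have hjθ' : j * θ + θ ≤ Real.pi := by nlinarith
  have hη : 0 < Real.sin (j * θ) := Real.sin_pos_of_pos_of_lt_pi (by linarith) (by linarith)
  have hm : 0 ≤ Real.sin (j * θ - θ) :=
    Real.sin_nonneg_of_nonneg_of_le_pi (by linarith) (by linarith)
  have hp : 0 ≤ Real.sin (j * θ + θ) :=
    Real.sin_nonneg_of_nonneg_of_le_pi (by linarith) hjθ'
  have e3 : a * Real.sin (j * θ - θ) + (1 - a) * Real.sin (j * θ + θ) = 0 := by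
    have h1 := Real.sin_sq_add_cos_sq (j * θ)
    rw [mul_assoc, Real.cos_two_mul, Real.sin_two_mul] at e1
    rw [Real.sin_sub, Real.sin_add]
    refine (mul_eq_zero.1 ?_).resolve_left hη.ne'
    linear_combination e1 / 2 + Real.cos θ * h1
  have hp0 : Real.sin (j * θ + θ) = 0 := by
    have h1 := mul_nonneg ha0 hm
    have h2 := mul_nonneg (sub_nonneg.2 ha1.le) hp
    exact (mul_eq_zero.1 (by linarith : (1 - a) * Real.sin (j * θ + θ) = 0)).resolve_left
      (by linarith)
  have hj2 : j * θ + θ = Real.pi := by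
    by_contra hne
    exact (Real.sin_pos_of_pos_of_lt_pi (by linarith) (lt_of_le_of_ne hjθ' hne)).ne' hp0
  have hm' : 0 < Real.sin (j * θ - θ) := by
    rw [show j * θ - θ = Real.pi - 2 * θ by linarith, Real.sin_pi_sub]
    have : (3 : ℝ) ≤ n := by exact_mod_cast hn
    exact Real.sin_pos_of_pos_of_lt_pi (by linarith) (by nlinarith)
  have ha : a = 0 := by
    rw [hp0, mul_zero, add_zero] at e3
    exact (mul_eq_zero.1 e3).resolve_right hm'.ne'
  rw [ha, show 2 * (j : ℝ) * θ = 2 * Real.pi - 2 * θ by linarith, Real.cos_two_pi_sub,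
    Real.sin_two_pi_sub, Real.cos_two_mul, Real.sin_two_mul] at e2
  have e4 : Real.sin θ * (2 * (t - j) - 2) = 0 := by
    linear_combination e2
  have := (mul_eq_zero.1 e4).resolve_left hS.ne'
  linarith

lemma gam_eq_gam_iff {n : ℕ} (hn : 3 ≤ n) {a t : ℝ} :
    gam n a = gam n t ↔ ∃ k : ℤ, t = a + n * k := by
  have hn0 : (0 : ℝ) < n := by exact_mod_cast (by omega : 0 < n)
  refine ⟨fun h => ?_, ?_⟩
  · set q : ℤ := ⌊(t - ⌊a⌋) / n⌋ with hq
    have h1 : (q : ℝ) * n ≤ t - ⌊a⌋ := (le_div_iff₀ hn0).1 (Int.floor_le _)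
    have h2 : t - ⌊a⌋ < (q + 1) * n := (div_lt_iff₀ hn0).1 (Int.lt_floor_add_one _)
    have h3 : gam n (a + (-⌊a⌋ : ℤ)) = gam n (t + (-⌊a⌋ : ℤ) + n * (-q : ℤ)) := by
      rw [gam_add_period (by omega), gam_add_int, gam_add_int, h]
    have h4 := gam_injOn hn (by push_cast; linarith [Int.floor_le a])
      (by push_cast; linarith [Int.lt_floor_add_one a]) (by push_cast; linarith)
      (by push_cast; linarith) h3
    refine ⟨q, ?_⟩
    push_cast at h4
    linarith
  · rintro ⟨k, rfl⟩
    rw [gam_add_period (by omega)]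

lemma polyArg_gam {n : ℕ} (hn : 3 ≤ n) (s : ℝ) : polyArg n (gam n s) = Int.fract (s / n) := by
  have hn0 : (n : ℝ) ≠ 0 := by exact_mod_cast (by omega : n ≠ 0)
  have : {t : ℝ | t ∈ Set.Ico (0 : ℝ) 1 ∧ polyParam n t = gam n s} = {Int.fract (s / n)} := by
    ext t
    rw [Set.mem_ofPred_eq, Set.mem_singleton_iff, polyParam_eq_gam, gam_eq_gam_iff hn, @eq_comm _ t,
      Int.fract_eq_iff, Set.mem_Ico, and_assoc]
    refine and_congr_right fun _ => and_congr_right fun _ => exists_congr fun k => ?_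
    rw [sub_eq_iff_eq_add, div_eq_iff hn0]
    constructor <;> intro h <;> linarith
  rw [polyArg, this, csInf_singleton]

lemma polyDist_gam {n : ℕ} (hn : 3 ≤ n) (s t : ℝ) :
    polyDist n (gam n s) (gam n t) = Int.fract ((t - s) / n) := by
  rw [polyDist, polyArg_gam hn, polyArg_gam hn, Int.fract_eq_fract]
  refine ⟨⌊s / n⌋ - ⌊t / n⌋, ?_⟩
  rw [Int.fract, Int.fract, sub_div]
  push_cast
  ring

lemma mem_polygon_iff {n : ℕ} (hn : n ≠ 0) {x : ℂ} : x ∈ polygon n ↔ ∃ t, gam n t = x := by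
  have hn0 : (0 : ℝ) < n := by exact_mod_cast Nat.pos_of_ne_zero hn
  simp only [polygon, Set.mem_iUnion, Finset.mem_range]
  constructor
  · rintro ⟨j, hj, hx⟩
    rw [segment_eq_image] at hx
    obtain ⟨τ, ⟨h0, h1⟩, rfl⟩ := hx
    refine ⟨j + τ, ?_⟩
    rw [gam_of_mem_edge (j := j) (by simpa using h0) (by simpa using h1)]
    simp only [Int.cast_natCast, add_sub_cancel_left, Complex.real_smul]
    norm_cast
  · rintro ⟨t, rfl⟩
    set j := ⌊t⌋ % n with hj
    have hj0 : 0 ≤ j := Int.emod_nonneg _ (by exact_mod_cast hn)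
    have hjn : j < n := Int.emod_lt_of_pos _ (by exact_mod_cast Nat.pos_of_ne_zero hn)
    obtain ⟨i, hi⟩ := Int.eq_ofNat_of_zero_le hj0
    refine ⟨i, by omega, ?_⟩
    have hf : (⌊t⌋ : ℝ) = i + n * (⌊t⌋ / n : ℤ) := by
      have := Int.emod_add_mul_ediv ⌊t⌋ n
      rw [← hj, hi] at this
      exact_mod_cast this.symm
    have hper : gam n t = gam n (i + Int.fract t) := by
      rw [← gam_add_period hn (i + Int.fract t) (⌊t⌋ / n), Int.fract]
      congr 1
      linarith
    rw [hper, gam_of_mem_edge (j := i) (by simp) (by simpa using (Int.fract_lt_one t).le),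
      segment_eq_image]
    refine ⟨Int.fract t, ⟨Int.fract_nonneg _, (Int.fract_lt_one t).le⟩, ?_⟩
    simp only [Int.cast_natCast, add_sub_cancel_left, Complex.real_smul]
    norm_cast

/-- The lift of the first vertices of a star to edge parameters. -/
noncomputable def starLift (n : ℕ) (u : ℕ → ℂ) (k : ℕ) : ℝ :=
  n * (polyArg n (u 0) + ∑ i ∈ Finset.range k, polyDist n (u i) (u (i + 1)))

lemma starLift_succ (n : ℕ) (u : ℕ → ℂ) (k : ℕ) :
    starLift n u (k + 1) = starLift n u k + n * polyDist n (u k) (u (k + 1)) := by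
  rw [starLift, Finset.sum_range_succ, starLift]
  ring

lemma exists_starLift_eq (n : ℕ) (u : ℕ → ℂ) (k : ℕ) :
    ∃ m : ℤ, starLift n u k = n * (polyArg n (u k) + m) := by
  induction k with
  | zero => exact ⟨0, by simp [starLift]⟩
  | succ k ih =>
    obtain ⟨m, hm⟩ := ih
    refine ⟨m - ⌊polyArg n (u (k + 1)) - polyArg n (u k)⌋, ?_⟩
    rw [starLift_succ, hm, polyDist, Int.fract]
    push_cast
    ring

lemma gam_starLift {n : ℕ} (hn : 3 ≤ n) {u : ℕ → ℂ} {k : ℕ} (hu : u k ∈ polygon n) :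
    gam n (starLift n u k) = u k := by
  have hn0 : (n : ℝ) ≠ 0 := by exact_mod_cast (by omega : n ≠ 0)
  obtain ⟨m, hm⟩ := exists_starLift_eq n u k
  obtain ⟨t, ht⟩ := (mem_polygon_iff (by omega)).1 hu
  rw [hm, ← ht, polyArg_gam hn, gam_eq_gam_iff hn]
  refine ⟨⌊t / n⌋ - m, ?_⟩
  rw [Int.fract]
  push_cast
  field_simp
  ring

lemma IsStar.firstHit {n l : ℕ} (hn : 3 ≤ n) {r : ℝ} (hr0 : 0 < r) {p : ℂ} {u : ℕ → ℂ}
    (hs : IsStar n l r p u) {k : ℕ} (hk : k ≤ 2 * l) :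
    FirstHit n r (starLift n u k) (starLift n u (k + 1)) := by
  obtain ⟨-, -, hmem, hdist, hbtw, -⟩ := hs
  have hn0 : (0 : ℝ) < n := by exact_mod_cast (by omega : 0 < n)
  have g0 := gam_starLift hn (hmem k (by omega))
  have g1 := gam_starLift hn (hmem (k + 1) (by omega))
  have hD : gdist n (starLift n u k) (starLift n u (k + 1)) = r := by
    rw [gdist, g0, g1, hdist k hk]
  have hsucc := starLift_succ n u k
  have hd0 : 0 ≤ polyDist n (u k) (u (k + 1)) := Int.fract_nonneg _
  have hd1 : polyDist n (u k) (u (k + 1)) < 1 := Int.fract_lt_one _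
  refine ⟨lt_of_le_of_ne (by nlinarith) fun h => ?_, hD, fun c h1 h2 => ?_⟩
  · rw [← h, gdist, dist_self] at hD
    exact hr0.ne hD
  · have hc0 : 0 < (c - starLift n u k) / n := div_pos (by linarith) hn0
    have hc1 : (c - starLift n u k) / n < polyDist n (u k) (u (k + 1)) := by
      rw [div_lt_iff₀ hn0]
      linarith
    have hc : polyDist n (u k) (gam n c) = (c - starLift n u k) / n := by
      nth_rewrite 1 [← g0]
      rw [polyDist_gam hn, Int.fract_eq_self]
      exact ⟨hc0.le, hc1.trans hd1⟩
    have := hbtw k hk (gam n c) ((mem_polygon_iff (by omega)).2 ⟨c, rfl⟩)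
      ⟨by rwa [hc], by rwa [hc]⟩
    rwa [gdist, g0]

lemma IsVertex.exists_int {n : ℕ} (hn : 3 ≤ n) {t : ℝ} (h : IsVertex n (gam n t)) :
    ∃ a : ℤ, t = a := by
  obtain ⟨j, -, hj⟩ := h
  rw [← zpow_natCast, ← gam_intCast, eq_comm, gam_eq_gam_iff hn] at hj
  obtain ⟨k, hk⟩ := hj
  exact ⟨j + n * k, by rw [hk]; push_cast; ring⟩

lemma IsMidpoint.exists_int {n : ℕ} (hn : 3 ≤ n) {t : ℝ} (h : IsMidpoint n (gam n t)) :
    ∃ a : ℤ, t = a + 1 / 2 := by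
  obtain ⟨j, -, hj⟩ := h
  have hmid : gam n ((j : ℤ) + 1 / 2) = (nroot n ^ j + nroot n ^ (j + 1)) / 2 := by
    rw [gam_of_mem_edge (j := j) (by norm_num) (by norm_num)]
    norm_cast
    push_cast
    ring
  rw [← hmid, eq_comm, gam_eq_gam_iff hn] at hj
  obtain ⟨k, hk⟩ := hj
  exact ⟨j + n * k, by rw [hk]; push_cast; ring⟩

/-- A star inscribed in `P_n` cannot have both a vertex coincidence and a midpoint coincidence:
if `(u 0, …, u (2l+1))` is an inscribed equilateral `(2l+1)`-pointed star in `P_n` of side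
length `r ∈ (0, r_n]`, then it is not the case that some `u i` (`i ≤ 2l`) is a vertex of `P_n`
and some `u j` (`j ≤ 2l`) is a midpoint of an edge of `P_n`. -/
theorem no_vertex_and_midpoint_coincidence (l n : ℕ) (hl : 1 ≤ l) (hn : 4 * l + 2 ≤ n)
    (r : ℝ) (hr0 : 0 < r) (hrn : r ≤ rpoly n) (p : ℂ) (u : ℕ → ℂ)
    (hs : IsStar n l r p u) :
    ¬ ((∃ i ≤ 2 * l, IsVertex n (u i)) ∧ (∃ j ≤ 2 * l, IsMidpoint n (u j))) := by
  rintro ⟨⟨i, hi, hvi⟩, j, hj, hmj⟩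
  have hn3 : 3 ≤ n := by omega
  have hmem := hs.2.2.1
  rw [← gam_starLift hn3 (hmem i (by omega))] at hvi
  rw [← gam_starLift hn3 (hmem j (by omega))] at hmj
  obtain ⟨a, ha⟩ := hvi.exists_int hn3
  obtain ⟨b, hb⟩ := hmj.exists_int hn3
  have hclose : starLift n u (2 * l + 1) = starLift n u 0 + (n * l : ℤ) := by
    rw [starLift, hs.2.2.2.2.2, starLift]
    simp
    ring
  set N : ℤ := 2 * l + 1 with hN
  set s : ℤ → ℝ := fun i => starLift n u (i % N).toNat + (n * l * (i / N) : ℤ) with hsdef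
  have hs_small : ∀ k : ℕ, k ≤ 2 * l → s k = starLift n u k := by
    intro k hk
    have h1 : (k : ℤ) % N = k := Int.emod_eq_of_lt (by omega) (by omega)
    have h2 : (k : ℤ) / N = 0 := Int.ediv_eq_zero_of_lt (by omega) (by omega)
    simp [hsdef, h1, h2]
  refine chain_no_vertex_midpoint (n := n) (s := s) (N := N) (M := n * l) (i := i) (j := j)
    (by omega) hrn (fun i => ?_) ⟨l, hN⟩ (fun i => ?_) ((hs_small i hi).trans ha)
    ((hs_small j hj).trans hb)
  · have h0 := Int.emod_nonneg i (by omega : N ≠ 0)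
    have h1 := Int.emod_lt_of_pos i (by omega : 0 < N)
    have hdm := Int.emod_add_mul_ediv i N
    obtain ⟨k, hk⟩ := Int.eq_ofNat_of_zero_le h0
    have hnext : s (i + 1) = starLift n u (k + 1) + (n * l * (i / N) : ℤ) := by
      rcases (by omega : k < 2 * l ∨ k = 2 * l) with hkl | hkl
      · have e : i + 1 = (k + 1 : ℕ) + N * (i / N) := by push_cast; linarith
        have e1 : (i + 1) % N = (k + 1 : ℕ) := by
          rw [e, Int.add_mul_emod_self_left]
          exact Int.emod_eq_of_lt (by omega) (by omega)
        have e2 : (i + 1) / N = i / N := by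
          nth_rewrite 1 [e]
          rw [Int.add_mul_ediv_left _ _ (by omega), Int.ediv_eq_zero_of_lt (by omega) (by omega),
            zero_add]
        simp only [hsdef, e1, e2, Int.toNat_natCast]
      · have e : i + 1 = N * (i / N + 1) := by
          rw [mul_add, mul_one]
          have : (k : ℤ) + 1 = N := by omega
          linarith
        have e1 : (i + 1) % N = 0 := by rw [e, Int.mul_emod_right]
        have e2 : (i + 1) / N = i / N + 1 := by
          nth_rewrite 1 [e]
          rw [Int.mul_ediv_cancel_left _ (by omega)]
        simp only [hsdef, e1, e2, Int.toNat_zero, hkl, hclose]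
        push_cast
        ring
    have hcur : s i = starLift n u k + (n * l * (i / N) : ℤ) := by
      simp only [hsdef, hk, Int.toNat_natCast]
    rw [hnext, hcur]
    exact (hs.firstHit hn3 hr0 (by omega)).add_int _
  · simp only [hsdef]
    rw [Int.add_emod_right, Int.add_ediv_of_dvd_right dvd_rfl, Int.ediv_self (by omega)]
    push_cast
    ring
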